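/- arXiv:2504.18304 — 2 statements merged into one kernel-verified Lean document; each statement's English description precedes it below -/
import Mathlib

section
/- The first group cohomology H¹(G, M) is isomorphic, as an R-module, to the quotient {(x, y) ∈ M × M : (β − 1)·x = (α − 1)·y} / {((α − 1)·u, (β − 1)·u) : u ∈ M}, the isomorphism being induced by evaluating a 1-cocycle at the two standard generators σ₁ and σ₂. -/
/-- The `R`-module of 1-cocycles `Z¹(G, M)` for the action of `G = ℤ × ℤ` on `M` in
which `(n, m)` acts as multiplication by `αⁿβᵐ`. -/
def Z1 (R M : Type*) [CommRing R] [AddCommGroup M] [Module R M] (α β : Rˣ) :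
    Submodule R (ℤ × ℤ → M) where
  carrier := {z | ∀ g h : ℤ × ℤ, z (g + h) = z g + ((α ^ g.1 * β ^ g.2 : Rˣ) : R) • z h}
  add_mem' := by
    intro z w hz hw
    intro g h
    simp only [Pi.add_apply, hz g h, hw g h, smul_add]
    abel
  zero_mem' := by intro g h; simp
  smul_mem' := by
    intro r z hz
    intro g h
    simp only [Pi.smul_apply, hz g h, smul_add]
    rw [smul_comm]

/-- The map `M → Map(G, M)`, `v ↦ (g ↦ g·v − v)`, whose image is the submodule of
1-coboundaries `B¹(G, M)`. -/
def coB (R M : Type*) [CommRing R] [AddCommGroup M] [Module R M] (α β : Rˣ) :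
    M →ₗ[R] (ℤ × ℤ → M) :=
  LinearMap.pi fun g => ((α ^ g.1 * β ^ g.2 : Rˣ) : R) • LinearMap.id - LinearMap.id

/-- The submodule `{(x, y) ∈ M × M : (β − 1)·x = (α − 1)·y}` of `M × M`. -/
def relPairs (R M : Type*) [CommRing R] [AddCommGroup M] [Module R M] (α β : Rˣ) :
    Submodule R (M × M) where
  carrier := {xy | ((β : R) - 1) • xy.1 = ((α : R) - 1) • xy.2}
  add_mem' := by
    intro x y hx hy
    simp only [Set.mem_setOf_eq, Prod.fst_add, Prod.snd_add, smul_add] at *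
    rw [hx, hy]
  zero_mem' := by simp
  smul_mem' := by
    intro r x hx
    simp only [Set.mem_setOf_eq, Prod.smul_fst, Prod.smul_snd] at *
    rw [smul_comm, hx, smul_comm]

/-- The map `u ↦ ((α − 1)·u, (β − 1)·u)`. -/
def cobPair (R M : Type*) [CommRing R] [AddCommGroup M] [Module R M] (α β : Rˣ) :
    M →ₗ[R] M × M :=
  LinearMap.prod (((α : R) - 1) • LinearMap.id) (((β : R) - 1) • LinearMap.id)

/-- The affine automorphism `v ↦ a·v + x` of `M`. -/
def unitAffineEquiv {R M : Type*} [CommRing R] [AddCommGroup M] [Module R M] (a : Rˣ) (x : M) :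
    M ≃ᵃ[R] M :=
  (DistribMulAction.toModuleAut R M a).toAffineEquiv.trans (AffineEquiv.constVAdd R M x)

section

variable {R M : Type*} [CommRing R] [AddCommGroup M] [Module R M]

theorem unitAffineEquiv_apply (a : Rˣ) (x v : M) :
    unitAffineEquiv a x v = x + (a : R) • v := rfl

theorem linearHom_unitAffineEquiv (a : Rˣ) (x : M) :
    AffineEquiv.linearHom (unitAffineEquiv a x) = DistribMulAction.toModuleAut R M a := by
  ext v
  rfl

variable {α β : Rˣ}

theorem commute_unitAffineEquiv {x y : M} (h : ((β : R) - 1) • x = ((α : R) - 1) • y) :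
    Commute (unitAffineEquiv α x) (unitAffineEquiv β y) := by
  ext v
  simp only [AffineEquiv.mul_def, AffineEquiv.trans_apply, unitAffineEquiv_apply]
  linear_combination (norm := module) -h

/-- The cocycle with prescribed values `x`, `y` at the generators: the orbit of `0` under the
affine action in which the generators act as `v ↦ α·v + x` and `v ↦ β·v + y`. -/
theorem affine_orbit_mem_Z1 {x y : M} (h : ((β : R) - 1) • x = ((α : R) - 1) • y) :
    (fun g : ℤ × ℤ => (unitAffineEquiv α x ^ g.1 * unitAffineEquiv β y ^ g.2) (0 : M)) ∈
      Z1 R M α β := by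
  intro g k
  have hlin : AffineEquiv.linearHom (unitAffineEquiv α x ^ g.1 * unitAffineEquiv β y ^ g.2) =
      DistribMulAction.toModuleAut R M (α ^ g.1 * β ^ g.2) := by
    simp only [map_mul, map_zpow, linearHom_unitAffineEquiv]
  have hmul : unitAffineEquiv α x ^ (g + k).1 * unitAffineEquiv β y ^ (g + k).2 =
      (unitAffineEquiv α x ^ g.1 * unitAffineEquiv β y ^ g.2) *
        (unitAffineEquiv α x ^ k.1 * unitAffineEquiv β y ^ k.2) := by
    rw [Prod.fst_add, Prod.snd_add, zpow_add, zpow_add]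
    exact Commute.mul_mul_mul_comm ((commute_unitAffineEquiv h).zpow_zpow _ _) _ _
  have haff (f : M ≃ᵃ[R] M) (v : M) : f v = f 0 + AffineEquiv.linearHom f v := by
    have := f.map_vadd 0 v
    rw [vadd_eq_add, vadd_eq_add, add_zero, add_comm] at this
    exact this
  beta_reduce
  rw [hmul, AffineEquiv.mul_def, AffineEquiv.trans_apply, haff, hlin]
  rfl

theorem Z1_map_zero {z : ℤ × ℤ → M} (hz : z ∈ Z1 R M α β) : z 0 = 0 := by
  simpa using hz 0 0

theorem Z1_eq_zero {z : ℤ × ℤ → M} (hz : z ∈ Z1 R M α β) (h₁ : z (1, 0) = 0)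
    (h₂ : z (0, 1) = 0) : z = 0 := by
  let S : AddSubgroup (ℤ × ℤ) :=
    { carrier := {g | z g = 0}
      zero_mem' := Z1_map_zero hz
      add_mem' := fun {g k} hg hk => by
        simp only [Set.mem_ofPred_eq] at *
        rw [hz, hg, hk, smul_zero, add_zero]
      neg_mem' := fun {g} hg => by
        simp only [Set.mem_ofPred_eq] at *
        have := hz g (-g)
        rw [add_neg_cancel, Z1_map_zero hz, hg, zero_add, ← Units.smul_def] at this
        exact (smul_eq_zero_iff_eq _).1 this.symm }
  ext ⟨n, m⟩
  have hmem : n • ((1, 0) : ℤ × ℤ) + m • ((0, 1) : ℤ × ℤ) ∈ S :=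
    S.add_mem (S.zsmul_mem h₁ n) (S.zsmul_mem h₂ m)
  simpa using (show z _ = 0 from hmem)

theorem Z1_eval_mem_relPairs {z : ℤ × ℤ → M} (hz : z ∈ Z1 R M α β) :
    (z (1, 0), z (0, 1)) ∈ relPairs R M α β := by
  have h₁ := hz (1, 0) (0, 1)
  have h₂ := hz (0, 1) (1, 0)
  rw [add_comm, h₂] at h₁
  simp only [zpow_zero, zpow_one, one_mul, mul_one] at h₁
  change ((β : R) - 1) • z (1, 0) = ((α : R) - 1) • z (0, 1)
  linear_combination (norm := module) h₁

variable (R M α β)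

/-- Evaluation of cocycles at the two standard generators. -/
def evalGenerators : Z1 R M α β →ₗ[R] relPairs R M α β where
  toFun z := ⟨(z.1 (1, 0), z.1 (0, 1)), Z1_eval_mem_relPairs z.2⟩
  map_add' _ _ := rfl
  map_smul' _ _ := rfl

theorem evalGenerators_bijective : Function.Bijective (evalGenerators R M α β) := by
  constructor
  · rw [← LinearMap.ker_eq_bot, LinearMap.ker_eq_bot']
    intro z hz
    have hz' := Prod.ext_iff.1 (congrArg Subtype.val hz)
    exact Subtype.ext (Z1_eq_zero z.2 hz'.1 hz'.2)
  · rintro ⟨⟨x, y⟩, h⟩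
    refine ⟨⟨_, affine_orbit_mem_Z1 h⟩, Subtype.ext (Prod.ext ?_ ?_)⟩ <;>
      simp [evalGenerators, unitAffineEquiv_apply]

theorem coB_mem_Z1 (v : M) : coB R M α β v ∈ Z1 R M α β := by
  intro g k
  simp only [coB, LinearMap.pi_apply, LinearMap.sub_apply, LinearMap.smul_apply,
    LinearMap.id_apply, Prod.fst_add, Prod.snd_add, zpow_add, Units.val_mul]
  module

theorem evalGenerators_coB (v : M) :
    (evalGenerators R M α β ⟨coB R M α β v, coB_mem_Z1 R M α β v⟩ : M × M) =
      cobPair R M α β v := by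
  simp [evalGenerators, coB, cobPair, sub_smul]

theorem map_evalGenerators_coboundaries :
    ((LinearMap.range (coB R M α β)).comap (Z1 R M α β).subtype).map (evalGenerators R M α β) =
      (LinearMap.range (cobPair R M α β)).comap (relPairs R M α β).subtype := by
  ext w
  constructor
  · rintro ⟨z, ⟨v, hv⟩, rfl⟩
    obtain rfl : ⟨coB R M α β v, coB_mem_Z1 R M α β v⟩ = z := Subtype.ext hv
    exact ⟨v, (evalGenerators_coB R M α β v).symm⟩
  · rintro ⟨v, hv⟩
    exact ⟨⟨coB R M α β v, coB_mem_Z1 R M α β v⟩, ⟨v, rfl⟩,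
      Subtype.ext ((evalGenerators_coB R M α β v).trans hv)⟩

end

/-- `H¹(G, M) = Z¹(G, M)/B¹(G, M)` is isomorphic, as an `R`-module, to
`{(x, y) ∈ M × M : (β − 1)·x = (α − 1)·y} / {((α − 1)·u, (β − 1)·u) : u ∈ M}`,
the isomorphism being induced by evaluation of a 1-cocycle at the two standard
generators `σ₁ = (1, 0)` and `σ₂ = (0, 1)`. -/
theorem stmt7 (R M : Type*) [CommRing R] [AddCommGroup M] [Module R M] (α β : Rˣ) :
    ∃ e : (↥(Z1 R M α β) ⧸
            (LinearMap.range (coB R M α β)).comap (Z1 R M α β).subtype) ≃ₗ[R]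
          (↥(relPairs R M α β) ⧸
            (LinearMap.range (cobPair R M α β)).comap (relPairs R M α β).subtype),
      ∀ (z : ↥(Z1 R M α β)) (w : ↥(relPairs R M α β)),
        (w : M × M) = ((z : ℤ × ℤ → M) (1, 0), (z : ℤ × ℤ → M) (0, 1)) →
          e (Submodule.Quotient.mk z) = Submodule.Quotient.mk w := by
  refine ⟨Submodule.Quotient.equiv _ _
    (LinearEquiv.ofBijective _ (evalGenerators_bijective R M α β))
    (map_evalGenerators_coboundaries R M α β), fun z w hw => ?_⟩
  obtain rfl : evalGenerators R M α β z = w := Subtype.ext hw.symm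
  rfl
end

section
/- Let R be a commutative ring and let a : A → B, c : A → A', b : B → B', δ : A' → B' be homomorphisms of R-modules satisfying δ ∘ c = b ∘ a. Suppose r, s, t ∈ R are such that r annihilates ker(a), t annihilates ker(b), and s annihilates coker(c) (i.e. s·A' ⊆ im(c)). Then r·s·t annihilates ker(δ). -/
/-- **Diagram chase for kernels.**
Let `R` be a commutative ring and let `a : A → B`, `c : A → A'`, `b : B → B'`,
`δ : A' → B'` be homomorphisms of `R`-modules satisfying `δ ∘ c = b ∘ a`.
Suppose `r, s, t ∈ R` are such that `r` annihilates `ker a`, `t` annihilates `ker b`,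
and `s` annihilates `coker c` (i.e. `s • A' ⊆ im c`).  Then `r * s * t` annihilates
`ker δ`. -/
theorem stmt12 {R A B A' B' : Type*} [CommRing R]
    [AddCommGroup A] [Module R A] [AddCommGroup B] [Module R B]
    [AddCommGroup A'] [Module R A'] [AddCommGroup B'] [Module R B']
    (a : A →ₗ[R] B) (c : A →ₗ[R] A') (b : B →ₗ[R] B') (δ : A' →ₗ[R] B')
    (hcomm : δ ∘ₗ c = b ∘ₗ a) (r s t : R)
    (hr : ∀ x ∈ LinearMap.ker a, r • x = 0)
    (ht : ∀ y ∈ LinearMap.ker b, t • y = 0)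
    (hs : ∀ x' : A', s • x' ∈ LinearMap.range c) :
    ∀ x' ∈ LinearMap.ker δ, (r * s * t) • x' = 0 := by
  intro x' hx'
  obtain ⟨x, hx⟩ := hs x'
  have hb : a x ∈ LinearMap.ker b := by
    rw [LinearMap.mem_ker, ← LinearMap.comp_apply, ← hcomm, LinearMap.comp_apply, hx,
      map_smul, LinearMap.mem_ker.mp hx', smul_zero]
  have ha : t • x ∈ LinearMap.ker a := by
    rw [LinearMap.mem_ker, map_smul, ht _ hb]
  calc (r * s * t) • x' = r • t • s • x' := by rw [mul_right_comm, mul_smul, mul_smul]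
    _ = c (r • t • x) := by rw [map_smul, map_smul, hx]
    _ = 0 := by rw [hr _ ha, map_zero]
end
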